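/- Let χ be a sign pattern for 𝔐 | 𝔑 and S = {𝔭 : 𝔭 | 𝔐}. All S-ideal classes in Cl_S(O) are χ-admissible if and only if dim M_𝟎^χ(O) = dim M_𝟎^{+_𝔐}(O), where +_𝔐 is the sign pattern with all signs +1. -/

import Mathlib

/-!
Abstract formalization of the setting of Martin, "Congruences for modular forms mod 2
and quaternionic S-ideal classes".  Throughout, `F` is a totally real number field
with narrow class number one, `B/F` a totally definite quaternion algebra of
discriminant `𝔑`, and `O ⊂ B` a maximal order.  The type `P` stands for the set of
finite primes of `F`; in the structure `QuatSetting`, `G` plays the role of the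
finite idele group `B̂ˣ`, `Bunits` of the diagonally embedded subgroup `Bˣ`,
`Ounits` of `Ôˣ`, `Lunits p` of the local unit group `B_𝔭ˣ` (inside `B̂ˣ`),
`Ram p` of the ramification condition `𝔭 ∣ 𝔑`, and `unif p` of a uniformizer
`ϖ_{B_𝔭}` of the local division algebra `B_𝔭`.
-/

noncomputable section

open scoped Classical

/-- The ring of algebraic integers, realized inside `ℂ`. -/
abbrev AlgInt : Type := integralClosure ℤ ℂ

/-- The finite-adelic data attached to a totally definite quaternion algebra `B`
over a totally real field `F` of narrow class number one with a maximal order `O`. -/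
structure QuatSetting (P : Type) where
  /-- the finite idele group `B̂ˣ` -/
  G : Type
  [grp : Group G]
  /-- the diagonally embedded `Bˣ` -/
  Bunits : Subgroup G
  /-- the unit group `Ôˣ` of the maximal order -/
  Ounits : Subgroup G
  /-- the local unit groups `B_𝔭ˣ` -/
  Lunits : P → Subgroup G
  /-- ramification of `B` at `𝔭`, i.e. `𝔭 ∣ 𝔑` -/
  Ram : P → Prop
  /-- a uniformizer `ϖ_{B_𝔭}` of `B_𝔭` for ramified `𝔭` -/
  unif : P → G
  unif_mem : ∀ p, Ram p → unif p ∈ Lunits p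
  /-- `ϖ_{B_𝔭}` normalizes `Ôˣ` (since `O_𝔭` is the unique maximal order of `B_𝔭`) -/
  unif_conj : ∀ p, Ram p → ∀ u : G, u ∈ Ounits ↔ unif p * u * (unif p)⁻¹ ∈ Ounits
  /-- `ϖ_{B_𝔭}² = ϖ_𝔭` is central and trivial in `Bˣ\B̂ˣ/Ôˣ` (as `h_F⁺ = 1`) -/
  unif_sq : ∀ p, Ram p → ∃ b ∈ Bunits, ∃ u ∈ Ounits, unif p ^ 2 = b * u

attribute [instance] QuatSetting.grp

namespace QuatSetting

variable {P : Type} (S : QuatSetting P)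

/-- The subgroup `Ô_Sˣ = ∏_{𝔭 ∈ S} B_𝔭ˣ × ∏_{𝔭 ∉ S} O_𝔭ˣ` of `B̂ˣ` attached to a
set `T` of (ramified) primes. -/
def USub (T : Set P) : Subgroup S.G := S.Ounits ⊔ ⨆ p ∈ T, S.Lunits p

/-- `x` and `y` define the same `T`-ideal class, i.e. the same element of
`Cl_T(O) = Bˣ \ B̂ˣ / Ô_Tˣ`. -/
def SRel (T : Set P) (x y : S.G) : Prop := ∃ b ∈ S.Bunits, ∃ u ∈ S.USub T, y = b * x * u

/-- `x` and `y` define the same right `O`-ideal class in `Cl(O) = Bˣ \ B̂ˣ / Ôˣ`. -/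
def Rel (x y : S.G) : Prop := ∃ b ∈ S.Bunits, ∃ u ∈ S.Ounits, y = b * x * u

/-- The right `O`-ideal class of `x`, as a subset of `B̂ˣ`. -/
def cls (x : S.G) : Set S.G := {y | S.Rel x y}

/-- The `T`-ideal class of `x`, as a subset of `B̂ˣ`. -/
def scls (T : Set P) (x : S.G) : Set S.G := {y | S.SRel T x y}

/-- The set `Cl(O)` of right `O`-ideal classes. -/
def Cl : Set (Set S.G) := Set.range S.cls

/-- The set `Cl_T(O)` of `T`-ideal classes. -/
def ClS (T : Set P) : Set (Set S.G) := Set.range (S.scls T)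

/-- The number `s_𝔭` of orbits of size 2 of the involution `σ_𝔭` (right multiplication
by `ϖ_{B_𝔭}`) on `Cl(O)`; equivalently, the number of `{𝔭}`-ideal classes consisting
of two right `O`-ideal classes. -/
def sOrbits (p : P) : ℕ :=
  Nat.card {C : Set S.G // ∃ x : S.G, C = S.scls {p} x ∧ ¬S.Rel x (x * S.unif p)}

section Weight

variable {V : Type} [AddCommGroup V] [Module ℂ V]

/-- The space `M_k(O)` of quaternionic modular forms of weight `(ρ_k, V_k)`, viewed as
`V`-valued functions on `B̂ˣ` satisfying `φ(γxu) = ρ(γ) φ(x)` for `γ ∈ Bˣ`, `u ∈ Ôˣ`. -/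
def Mk (ρ : Representation ℂ S.Bunits V) : Submodule ℂ (S.G → V) where
  carrier := {φ | ∀ b : S.Bunits, ∀ u ∈ S.Ounits, ∀ x : S.G,
    φ ((b : S.G) * x * u) = ρ b (φ x)}
  add_mem' := by
    intro φ ψ hφ hψ b u hu x
    simp only [Pi.add_apply, hφ b u hu x, hψ b u hu x, map_add]
  zero_mem' := by
    intro b u hu x
    simp
  smul_mem' := by
    intro c φ hφ b u hu x
    simp only [Pi.smul_apply, hφ b u hu x, map_smul]

/-- The `e`-eigenspace condition for the ramified Hecke operator
`(T_𝔭 φ)(x) = φ(x ϖ_{B_𝔭})`. -/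
def eigSub (p : P) (e : ℂ) : Submodule ℂ (S.G → V) where
  carrier := {φ | ∀ x : S.G, φ (x * S.unif p) = e • φ x}
  add_mem' := by
    intro φ ψ hφ hψ x
    simp only [Pi.add_apply, hφ x, hψ x, smul_add]
  zero_mem' := by
    intro x
    simp
  smul_mem' := by
    intro c φ hφ x
    simp only [Pi.smul_apply, hφ x]
    exact smul_comm c e (φ x)

/-- The space `M_k^χ(O)`: quaternionic forms of weight `k` on which the ramified Hecke
operator `T_𝔭` acts by `χ_𝔭` for all `𝔭 ∈ T` (equivalently, the span of the eigenforms
with these signs). -/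
def Mkχ (ρ : Representation ℂ S.Bunits V) (T : Set P) (χ : P → ℂ) : Submodule ℂ (S.G → V) :=
  S.Mk ρ ⊓ ⨅ p ∈ T, S.eigSub (V := V) p (χ p)

/-- The fixed subspace `V_k^{Γ(x)}`, where `Γ(x) = x Ôˣ x⁻¹ ∩ Bˣ`. -/
def GammaFixed (ρ : Representation ℂ S.Bunits V) (x : S.G) : Set V :=
  {v | ∀ b : S.Bunits, (∃ u ∈ S.Ounits, (b : S.G) = x * u * x⁻¹) → ρ b v = v}

/-- The set `Γ^{σ_𝔭}(x) = x ϖ_{B_𝔭} Ôˣ x⁻¹ ∩ Bˣ` (for `x` a fixed point of `σ_𝔭`). -/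
def GammaSigma (p : P) (x : S.G) : Set S.Bunits :=
  {γ | ∃ u ∈ S.Ounits, (γ : S.G) = x * S.unif p * u * x⁻¹}

/-- The `S`-ideal class of `x` is `χ`-admissible in weight `k = (ρ, V)`: every vector of
`V_k^{Γ(x)}` is the value at `x` of some form in `M_k^χ(O)`. -/
def Admissible (ρ : Representation ℂ S.Bunits V) (T : Set P) (χ : P → ℂ) (x : S.G) : Prop :=
  ∀ v ∈ S.GammaFixed ρ x, ∃ φ ∈ S.Mkχ ρ T χ, φ x = v

end Weight

/-- The weight-zero space `M_𝟎(O)` of `ℂ`-valued functions on `Cl(O)`. -/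
def M0 : Submodule ℂ (S.G → ℂ) := S.Mk (Representation.trivial ℂ (G := S.Bunits) (V := ℂ))

/-- The simultaneous eigenspace `M_𝟎^χ(O)`. -/
def M0chi (T : Set P) (χ : P → ℂ) : Submodule ℂ (S.G → ℂ) :=
  S.Mkχ (Representation.trivial ℂ (G := S.Bunits) (V := ℂ)) T χ

/-- The `S`-ideal class of `x₀` is `χ`-admissible (in weight `𝟎`):  there is a partition
of the right `O`-ideal classes contained in it (recorded by a `±1`-valued function `ε`
constant on `O`-ideal classes) such that the edges of the signed graph `Σ_χ` joining the
two parts are exactly those of sign `-1`, i.e. `ε(σ_𝔭 x) = χ_𝔭 ε(x)` for all `𝔭 ∈ T`. -/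
def AdmissibleWt0 (T : Set P) (χ : P → ℂ) (x₀ : S.G) : Prop :=
  ∃ ε : S.G → ℂ, (∀ x y : S.G, S.Rel x y → ε x = ε y) ∧
    (∀ x : S.G, S.SRel T x₀ x → ε x = 1 ∨ ε x = -1) ∧
    ∀ p ∈ T, ∀ x : S.G, S.SRel T x₀ x → ε (x * S.unif p) = χ p * ε x

end QuatSetting

namespace QuatSetting

variable {P : Type} (S : QuatSetting P)

theorem mem_M0chi (T : Set P) (χ : P → ℂ) (φ : S.G → ℂ) :
    φ ∈ S.M0chi T χ ↔ (∀ x y, S.Rel x y → φ y = φ x) ∧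
      ∀ p ∈ T, ∀ x, φ (x * S.unif p) = χ p * φ x := by
  unfold M0chi Mkχ
  rw [Submodule.mem_inf]
  simp only [Submodule.mem_iInf]
  refine and_congr ?_ ?_
  · constructor
    · rintro h x y ⟨b, hb, u, hu, rfl⟩
      exact h ⟨b, hb⟩ u hu x
    · intro h b u hu x
      exact h x _ ⟨b, b.2, u, hu, rfl⟩
  · rfl

theorem rel_self (x : S.G) : S.Rel x x := ⟨1, one_mem _, 1, one_mem _, by simp⟩

theorem Rel.srel {x y : S.G} (T : Set P) (h : S.Rel x y) : S.SRel T x y := by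
  obtain ⟨b, hb, u, hu, rfl⟩ := h
  exact ⟨b, hb, u, Subgroup.mem_sup_left hu, rfl⟩

theorem srel_unif (T : Set P) (hT : ∀ p ∈ T, S.Ram p) (p : P) (hp : p ∈ T) (x : S.G) :
    S.SRel T x (x * S.unif p) := by
  refine ⟨1, one_mem _, S.unif p, Subgroup.mem_sup_right ?_, by simp⟩
  exact (le_iSup₂ (f := fun p (_ : p ∈ T) => S.Lunits p) p hp) (S.unif_mem p (hT p hp))

/-- The equivalence relation of lying in the same `T`-ideal class. -/
def sSetoid (T : Set P) : Setoid S.G where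
  r := S.SRel T
  iseqv := by
    refine ⟨fun x => (S.rel_self x).srel S T, ?_, ?_⟩
    · rintro x y ⟨b, hb, u, hu, rfl⟩
      exact ⟨b⁻¹, inv_mem hb, u⁻¹, inv_mem hu, by group⟩
    · rintro x y z ⟨b, hb, u, hu, rfl⟩ ⟨c, hc, v, hv, rfl⟩
      exact ⟨c * b, mul_mem hc hb, u * v, mul_mem hu hv, by group⟩

/-- Being joined by one edge of the signed graph. -/
def Step (T : Set P) (x y : S.G) : Prop := S.Rel x y ∨ ∃ p ∈ T, y = x * S.unif p

theorem eqvGen_sign (T : Set P) (χ : P → ℂ) (hχ : ∀ p ∈ T, χ p = 1 ∨ χ p = -1)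
    (φ : S.G → ℂ) (hφ : φ ∈ S.M0chi T χ) (x y : S.G)
    (h : Relation.EqvGen (S.Step T) x y) : φ y = φ x ∨ φ y = - φ x := by
  rw [mem_M0chi] at hφ
  induction h with
  | rel x y h =>
    rcases h with h | ⟨p, hp, rfl⟩
    · exact Or.inl (hφ.1 _ _ h)
    · rw [hφ.2 p hp x]
      rcases hχ p hp with h | h <;> simp [h]
  | refl x => exact Or.inl rfl
  | symm x y _ ih => rcases ih with h | h <;> simp [h]
  | trans x y z _ _ ih1 ih2 =>
    rcases ih1 with h | h <;> rcases ih2 with h' | h' <;> simp [h, h']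

theorem finite_M0chi (hfin : S.Cl.Finite) (T : Set P) (χ : P → ℂ) :
    FiniteDimensional ℂ (S.M0chi T χ) := by
  have : Finite S.Cl := hfin
  let f : S.G → S.Cl := fun x => ⟨S.cls x, x, rfl⟩
  refine Submodule.finiteDimensional_of_le
    (S₂ := LinearMap.range (LinearMap.funLeft ℂ ℂ f)) ?_
  intro φ hφ
  rw [mem_M0chi] at hφ
  refine ⟨fun C => φ C.2.choose, ?_⟩
  ext x
  have h : S.cls (f x).2.choose = S.cls x := (f x).2.choose_spec
  have hx : x ∈ S.cls (f x).2.choose := by rw [h]; exact S.rel_self x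
  exact (hφ.1 _ _ hx).symm

theorem mul_mem_M0chi (T : Set P) (χ ψ : P → ℂ) (φ E : S.G → ℂ)
    (hφ : φ ∈ S.M0chi T χ) (hE : E ∈ S.M0chi T ψ) :
    E * φ ∈ S.M0chi T (ψ * χ) := by
  rw [mem_M0chi] at *
  refine ⟨fun x y h => ?_, fun p hp x => ?_⟩
  · simp [hφ.1 x y h, hE.1 x y h]
  · simp only [Pi.mul_apply, hφ.2 p hp x, hE.2 p hp x]; ring

theorem M0chi_congr (T : Set P) (χ ψ : P → ℂ) (h : ∀ p ∈ T, χ p = ψ p) :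
    S.M0chi T χ = S.M0chi T ψ := by
  ext φ
  rw [mem_M0chi, mem_M0chi]
  refine and_congr Iff.rfl (forall₂_congr fun p hp => ?_)
  rw [h p hp]

theorem finrank_eq_of_sign (T : Set P) (χ : P → ℂ) (hχ : ∀ p ∈ T, χ p = 1 ∨ χ p = -1)
    (E : S.G → ℂ) (hE : E ∈ S.M0chi T χ) (hE1 : ∀ x, E x = 1 ∨ E x = -1) :
    Module.finrank ℂ (S.M0chi T χ) = Module.finrank ℂ (S.M0chi T fun _ => 1) := by
  have hEE : E * E = 1 := by
    ext x
    rcases hE1 x with h | h <;> simp [h]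
  have h1 : ∀ φ ∈ S.M0chi T χ, E * φ ∈ S.M0chi T fun _ => 1 := by
    intro φ hφ
    rw [M0chi_congr S T (fun _ => 1) (χ * χ)]
    · exact S.mul_mem_M0chi T _ _ _ _ hφ hE
    · intro p hp
      rcases hχ p hp with h | h <;> simp [h]
  have h2 : ∀ φ ∈ (S.M0chi T fun _ => 1), E * φ ∈ S.M0chi T χ := by
    intro φ hφ
    rw [M0chi_congr S T χ (χ * fun _ => 1)]
    · exact S.mul_mem_M0chi T _ _ _ _ hφ hE
    · intro p hp
      simp
  let L : (S.G → ℂ) →ₗ[ℂ] (S.G → ℂ) := LinearMap.mulLeft ℂ E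
  refine LinearEquiv.finrank_eq (LinearEquiv.ofLinearMap (L.restrict h1) (L.restrict h2) ?_ ?_)
  · ext φ : 2
    change E * (E * φ.1) = φ.1
    rw [← mul_assoc, hEE, one_mul]
  · ext φ : 2
    change E * (E * φ.1) = φ.1
    rw [← mul_assoc, hEE, one_mul]

theorem exists_sign_of_finrank (hfin : S.Cl.Finite) (T : Set P) (χ : P → ℂ)
    (hχ : ∀ p ∈ T, χ p = 1 ∨ χ p = -1)
    (h : Module.finrank ℂ (S.M0chi T χ) = Module.finrank ℂ (S.M0chi T fun _ => 1)) :
    ∃ E ∈ S.M0chi T χ, ∀ x, E x = 1 ∨ E x = -1 := by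
  have := S.finite_M0chi hfin T χ
  have := S.finite_M0chi hfin T fun _ => 1
  let st : Setoid S.G := Relation.EqvGen.setoid (S.Step T)
  let r : S.G → S.G := fun x => (Quotient.mk st x).out
  have hr : ∀ x, Relation.EqvGen (S.Step T) (r x) x := fun x => Quotient.mk_out (s := st) x
  have hr2 : ∀ x y, S.Step T x y → r y = r x := fun x y hxy => by
    have : Quotient.mk st x = Quotient.mk st y := Quotient.sound (Relation.EqvGen.rel _ _ hxy)
    simp only [r, this]
  let L : (S.G → ℂ) →ₗ[ℂ] (S.G → ℂ) := LinearMap.funLeft ℂ ℂ r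
  have h1 : ∀ φ ∈ S.M0chi T χ, L φ ∈ S.M0chi T fun _ => 1 := by
    intro φ _
    rw [mem_M0chi]
    refine ⟨fun x y hxy => ?_, fun p hp x => ?_⟩
    · change φ (r y) = φ (r x)
      rw [hr2 x y (Or.inl hxy)]
    · change φ (r _) = 1 * φ (r x)
      rw [hr2 x _ (Or.inr ⟨p, hp, rfl⟩), one_mul]
  have hinj : Function.Injective (L.restrict h1) := by
    rw [injective_iff_map_eq_zero]
    intro φ hφ
    ext x
    have h0 : φ.1 (r x) = 0 := congrFun (congrArg Subtype.val hφ) x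
    rcases S.eqvGen_sign T χ hχ φ.1 φ.2 _ _ (hr x) with h | h <;> simp [h, h0]
  have hsurj := (LinearMap.injective_iff_surjective_of_finrank_eq_finrank h).1 hinj
  have hone : (1 : S.G → ℂ) ∈ S.M0chi T fun _ => 1 := by
    rw [mem_M0chi]; simp
  obtain ⟨φ, hφ⟩ := hsurj ⟨1, hone⟩
  refine ⟨φ.1, φ.2, fun x => ?_⟩
  have h0 : φ.1 (r x) = 1 := congrFun (congrArg Subtype.val hφ) x
  have := S.eqvGen_sign T χ hχ φ.1 φ.2 _ _ (hr x)
  rwa [h0] at this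

theorem exists_sign_of_admissible (T : Set P) (hT : ∀ p ∈ T, S.Ram p) (χ : P → ℂ)
    (h : ∀ x, S.AdmissibleWt0 T χ x) :
    ∃ E ∈ S.M0chi T χ, ∀ x, E x = 1 ∨ E x = -1 := by
  choose ε h1 h2 h3 using h
  let r : S.G → S.G := fun x => (Quotient.mk (S.sSetoid T) x).out
  have hr : ∀ x, S.SRel T (r x) x := fun x => Quotient.mk_out (s := S.sSetoid T) x
  have hr2 : ∀ x y, S.SRel T x y → r y = r x := fun x y hxy => by
    have : Quotient.mk (S.sSetoid T) x = Quotient.mk (S.sSetoid T) y := Quotient.sound hxy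
    simp only [r, this]
  refine ⟨fun x => ε (r x) x, ?_, fun x => h2 _ _ (hr x)⟩
  rw [mem_M0chi]
  refine ⟨fun x y hxy => ?_, fun p hp x => ?_⟩
  · simp only [hr2 x y (hxy.srel S T)]
    exact (h1 _ _ _ hxy).symm
  · simp only [hr2 x _ (S.srel_unif T hT p hp x)]
    exact h3 _ p hp x (hr x)

end QuatSetting

/-- Corollary in §4.4: all `S`-ideal classes are `χ`-admissible if
and only if `dim M_𝟎^χ(O) = dim M_𝟎^{+_𝔐}(O)`. -/
theorem stmt13 {P : Type} (S : QuatSetting P) (hfin : S.Cl.Finite)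
    (Mset : Set P) (hM : ∀ p ∈ Mset, S.Ram p)
    (χ : P → ℂ) (hχ : ∀ p ∈ Mset, χ p = 1 ∨ χ p = -1) :
    (∀ x : S.G, S.AdmissibleWt0 Mset χ x) ↔
      Module.finrank ℂ (S.M0chi Mset χ) =
        Module.finrank ℂ (S.M0chi Mset fun _ => 1) := by
  constructor
  · intro h
    obtain ⟨E, hE, hE1⟩ := S.exists_sign_of_admissible Mset hM χ h
    exact S.finrank_eq_of_sign Mset χ hχ E hE hE1
  · intro h x
    obtain ⟨E, hE, hE1⟩ := S.exists_sign_of_finrank hfin Mset χ hχ h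
    rw [QuatSetting.mem_M0chi] at hE
    exact ⟨E, fun x y hxy => (hE.1 x y hxy).symm, fun x _ => hE1 x,
      fun p hp x _ => hE.2 p hp x⟩
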